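/- Let V : (0,2] → ℝ be defined by V(r) = (1+t)⁵ + (t+1)²(t−1/3)²(t+1/3)²(t²−5/9)² / (6(1−t)²), where t = 1 − r²/2. Then every 20-point configuration C on the unit sphere S² ⊂ ℝ³ satisfies E_V(C) ≥ 2240/3, and the regular dodecahedron configuration attains this bound: E_V(dodecahedron) = 2240/3. -/

import Mathlib

open scoped Classical

/-- The `V`-potential energy of a finite configuration `C`:
`E_V(C) = (1/2) ∑_{x,y ∈ C, x ≠ y} V(|x-y|)`. -/
noncomputable def energy {n : ℕ} (V : ℝ → ℝ) (C : Finset (EuclideanSpace ℝ (Fin n))) : ℝ :=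
  (1 / 2) * ∑ x ∈ C, ∑ y ∈ C, if x = y then 0 else V (dist x y)

/-- The distance distribution of a finite configuration: `d_C(r)` is the number of
unordered pairs of distinct points of `C` at Euclidean distance `r`. -/
noncomputable def distDistrib {n : ℕ} (C : Finset (EuclideanSpace ℝ (Fin n))) : ℝ → ℝ :=
  fun r => ((C ×ˢ C).filter fun p => p.1 ≠ p.2 ∧ dist p.1 p.2 = r).card / 2

/-- `C` lies on the unit sphere `S^{n-1}`. -/
def onSphere {n : ℕ} (C : Finset (EuclideanSpace ℝ (Fin n))) : Prop :=
  ∀ x ∈ C, ‖x‖ = 1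

/-- `C'` is the image of `C` under an orthogonal transformation of `ℝ^n`. -/
def isOrthImage {n : ℕ} (C C' : Finset (EuclideanSpace ℝ (Fin n))) : Prop :=
  ∃ O : EuclideanSpace ℝ (Fin n) ≃ₗᵢ[ℝ] EuclideanSpace ℝ (Fin n), C' = C.image O

/-- The golden ratio. -/
noncomputable def phi : ℝ := (1 + Real.sqrt 5) / 2

/-- The regular dodecahedron configuration: the 8 points `(±1, ±1, ±1)/√3` together with
the 12 cyclic permutations of the coordinates of `(0, ±1/φ, ±φ)/√3`. -/
noncomputable def dodecConfig : Finset (EuclideanSpace ℝ (Fin 3)) :=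
  (Finset.image (fun s : Fin 3 → Bool =>
      (Real.sqrt 3)⁻¹ • (WithLp.equiv 2 (Fin 3 → ℝ)).symm
        (fun i => if s i then 1 else -1)) Finset.univ) ∪
  (Finset.image (fun s : Bool × Bool =>
      (Real.sqrt 3)⁻¹ • (WithLp.equiv 2 (Fin 3 → ℝ)).symm
        ![0, (if s.1 then 1 else -1) * phi⁻¹, (if s.2 then 1 else -1) * phi]) Finset.univ) ∪
  (Finset.image (fun s : Bool × Bool =>
      (Real.sqrt 3)⁻¹ • (WithLp.equiv 2 (Fin 3 → ℝ)).symm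
        ![(if s.2 then 1 else -1) * phi, 0, (if s.1 then 1 else -1) * phi⁻¹]) Finset.univ) ∪
  (Finset.image (fun s : Bool × Bool =>
      (Real.sqrt 3)⁻¹ • (WithLp.equiv 2 (Fin 3 → ℝ)).symm
        ![(if s.1 then 1 else -1) * phi⁻¹, (if s.2 then 1 else -1) * phi, 0]) Finset.univ)

/-- The potential of Theorem 3 (the dodecahedron theorem), as a function of the inner
product `t = 1 - r²/2`. -/
noncomputable def dodecW : ℝ → ℝ := fun t =>
  (1 + t) ^ 5 +
    (t + 1) ^ 2 * (t - 1 / 3) ^ 2 * (t + 1 / 3) ^ 2 * (t ^ 2 - 5 / 9) ^ 2 /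
      (6 * (1 - t) ^ 2)

/-- The potential of Theorem 3 (the dodecahedron theorem). -/
noncomputable def dodecV : ℝ → ℝ := fun r => dodecW (1 - r ^ 2 / 2)

lemma sum_sum_mul_mul {α : Type*} (C : Finset α) (c : ℝ) (f : α → ℝ) :
    ∑ x ∈ C, ∑ y ∈ C, c * (f x * f y) = c * (∑ x ∈ C, f x) ^ 2 := by
  rw [sq, Finset.sum_mul_sum, Finset.mul_sum]
  simp_rw [Finset.mul_sum]

/-- The kernel `⟪x, y⟫ ^ k` is positive semidefinite. -/
lemma sum_sum_inner_pow_nonneg {n : ℕ} (C : Finset (EuclideanSpace ℝ (Fin n))) (k : ℕ) :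
    0 ≤ ∑ x ∈ C, ∑ y ∈ C, inner ℝ x y ^ k := by
  have key : ∑ x ∈ C, ∑ y ∈ C, inner ℝ x y ^ k =
      ∑ p : Fin k → Fin n, (∑ x ∈ C, ∏ i, x (p i)) ^ 2 := by
    simp_rw [PiLp.inner_apply, Fintype.sum_pow, sq, Finset.sum_mul_sum]
    rw [Finset.sum_comm]
    simp_rw [Finset.sum_comm (s := C) (t := (Finset.univ : Finset (Fin k → Fin n)))]
    refine Finset.sum_congr rfl fun p _ => ?_
    refine Finset.sum_congr rfl fun x _ => Finset.sum_congr rfl fun y _ => ?_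
    rw [← Finset.prod_mul_distrib]
    simp
  rw [key]
  exact Finset.sum_nonneg fun _ _ => sq_nonneg _

lemma inner_fin_three (x y : EuclideanSpace ℝ (Fin 3)) :
    inner ℝ x y = x 0 * y 0 + x 1 * y 1 + x 2 * y 2 := by
  simp only [PiLp.inner_apply, Fin.sum_univ_three, RCLike.inner_apply, conj_trivial]
  ring

lemma sq_add_sq_add_sq_of_norm_eq_one {x : EuclideanSpace ℝ (Fin 3)} (hx : ‖x‖ = 1) :
    x 0 ^ 2 + x 1 ^ 2 + x 2 ^ 2 = 1 := by
  have h := real_inner_self_eq_norm_sq x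
  rw [inner_fin_three, hx] at h
  linarith

lemma sum_sum_inner_sq_ge {C : Finset (EuclideanSpace ℝ (Fin 3))} (hC : onSphere C) :
    (C.card : ℝ) ^ 2 / 3 ≤ ∑ x ∈ C, ∑ y ∈ C, inner ℝ x y ^ 2 := by
  have key : ∑ x ∈ C, ∑ y ∈ C, inner ℝ x y ^ 2 =
      1 * (∑ x ∈ C, x 0 ^ 2) ^ 2 + 1 * (∑ x ∈ C, x 1 ^ 2) ^ 2 + 1 * (∑ x ∈ C, x 2 ^ 2) ^ 2 +
      2 * (∑ x ∈ C, x 0 * x 1) ^ 2 + 2 * (∑ x ∈ C, x 0 * x 2) ^ 2 +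
      2 * (∑ x ∈ C, x 1 * x 2) ^ 2 := by
    simp only [← sum_sum_mul_mul, ← Finset.sum_add_distrib]
    refine Finset.sum_congr rfl fun x _ => Finset.sum_congr rfl fun y _ => ?_
    rw [inner_fin_three]
    ring
  have hcard : (C.card : ℝ) =
      ∑ x ∈ C, x 0 ^ 2 + ∑ x ∈ C, x 1 ^ 2 + ∑ x ∈ C, x 2 ^ 2 := by
    rw [← Finset.sum_add_distrib, ← Finset.sum_add_distrib, Finset.card_eq_sum_ones]
    push_cast
    exact Finset.sum_congr rfl fun x hx => (sq_add_sq_add_sq_of_norm_eq_one (hC x hx)).symm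
  rw [key, hcard]
  generalize ∑ x ∈ C, x 0 ^ 2 = a, ∑ x ∈ C, x 1 ^ 2 = b, ∑ x ∈ C, x 2 ^ 2 = c
  have h₁ := sq_nonneg (∑ x ∈ C, x 0 * x 1)
  have h₂ := sq_nonneg (∑ x ∈ C, x 0 * x 2)
  have h₃ := sq_nonneg (∑ x ∈ C, x 1 * x 2)
  linarith [sq_nonneg (a - b), sq_nonneg (a - c), sq_nonneg (b - c)]

lemma sum_sum_inner_pow_four_ge {C : Finset (EuclideanSpace ℝ (Fin 3))} (hC : onSphere C) :
    (C.card : ℝ) ^ 2 / 5 ≤ ∑ x ∈ C, ∑ y ∈ C, inner ℝ x y ^ 4 := by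
  have key : ∑ x ∈ C, ∑ y ∈ C, inner ℝ x y ^ 4 =
      1 * (∑ x ∈ C, x 0 ^ 4) ^ 2 + 1 * (∑ x ∈ C, x 1 ^ 4) ^ 2 + 1 * (∑ x ∈ C, x 2 ^ 4) ^ 2 +
      6 * (∑ x ∈ C, x 0 ^ 2 * x 1 ^ 2) ^ 2 + 6 * (∑ x ∈ C, x 0 ^ 2 * x 2 ^ 2) ^ 2 +
      6 * (∑ x ∈ C, x 1 ^ 2 * x 2 ^ 2) ^ 2 +
      (4 * (∑ x ∈ C, x 0 ^ 3 * x 1) ^ 2 + 4 * (∑ x ∈ C, x 0 ^ 3 * x 2) ^ 2 +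
      4 * (∑ x ∈ C, x 1 ^ 3 * x 0) ^ 2 + 4 * (∑ x ∈ C, x 1 ^ 3 * x 2) ^ 2 +
      4 * (∑ x ∈ C, x 2 ^ 3 * x 0) ^ 2 + 4 * (∑ x ∈ C, x 2 ^ 3 * x 1) ^ 2 +
      12 * (∑ x ∈ C, x 0 ^ 2 * x 1 * x 2) ^ 2 + 12 * (∑ x ∈ C, x 0 * x 1 ^ 2 * x 2) ^ 2 +
      12 * (∑ x ∈ C, x 0 * x 1 * x 2 ^ 2) ^ 2) := by
    simp only [← sum_sum_mul_mul, ← Finset.sum_add_distrib]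
    refine Finset.sum_congr rfl fun x _ => Finset.sum_congr rfl fun y _ => ?_
    rw [inner_fin_three]
    ring
  have hcard : (C.card : ℝ) =
      ∑ x ∈ C, x 0 ^ 4 + ∑ x ∈ C, x 1 ^ 4 + ∑ x ∈ C, x 2 ^ 4 +
      2 * ∑ x ∈ C, x 0 ^ 2 * x 1 ^ 2 + 2 * ∑ x ∈ C, x 0 ^ 2 * x 2 ^ 2 +
      2 * ∑ x ∈ C, x 1 ^ 2 * x 2 ^ 2 := by
    simp only [Finset.mul_sum, ← Finset.sum_add_distrib]
    rw [Finset.card_eq_sum_ones]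
    push_cast
    refine Finset.sum_congr rfl fun x hx => ?_
    linear_combination
      -(x 0 ^ 2 + x 1 ^ 2 + x 2 ^ 2 + 1) * sq_add_sq_add_sq_of_norm_eq_one (hC x hx)
  rw [key, hcard]
  refine le_add_of_le_of_nonneg ?_ (by positivity)
  generalize ∑ x ∈ C, x 0 ^ 4 = a, ∑ x ∈ C, x 1 ^ 4 = b, ∑ x ∈ C, x 2 ^ 4 = c,
    ∑ x ∈ C, x 0 ^ 2 * x 1 ^ 2 = d, ∑ x ∈ C, x 0 ^ 2 * x 2 ^ 2 = e,
    ∑ x ∈ C, x 1 ^ 2 * x 2 ^ 2 = f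
  linarith [sq_nonneg (a - b), sq_nonneg (a - c), sq_nonneg (b - c), sq_nonneg (a - 3 * d),
    sq_nonneg (a - 3 * e), sq_nonneg (a - 3 * f), sq_nonneg (b - 3 * d),
    sq_nonneg (b - 3 * e), sq_nonneg (b - 3 * f), sq_nonneg (c - 3 * d),
    sq_nonneg (c - 3 * e), sq_nonneg (c - 3 * f), sq_nonneg (d - e), sq_nonneg (d - f),
    sq_nonneg (e - f)]

lemma sum_sum_one_add_inner_pow_five_ge {C : Finset (EuclideanSpace ℝ (Fin 3))}
    (hC : onSphere C) :
    16 / 3 * (C.card : ℝ) ^ 2 ≤ ∑ x ∈ C, ∑ y ∈ C, (1 + inner ℝ x y) ^ 5 := by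
  have key : ∑ x ∈ C, ∑ y ∈ C, (1 + inner ℝ x y) ^ 5 =
      (C.card : ℝ) ^ 2 + 5 * ∑ x ∈ C, ∑ y ∈ C, inner ℝ x y ^ 1 +
      10 * ∑ x ∈ C, ∑ y ∈ C, inner ℝ x y ^ 2 + 10 * ∑ x ∈ C, ∑ y ∈ C, inner ℝ x y ^ 3 +
      5 * ∑ x ∈ C, ∑ y ∈ C, inner ℝ x y ^ 4 + ∑ x ∈ C, ∑ y ∈ C, inner ℝ x y ^ 5 := by
    have hcard : (C.card : ℝ) ^ 2 = ∑ x ∈ C, ∑ y ∈ C, 1 := by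
      simp [sq]
    rw [hcard]
    simp only [Finset.mul_sum, ← Finset.sum_add_distrib]
    refine Finset.sum_congr rfl fun x _ => Finset.sum_congr rfl fun y _ => ?_
    ring
  rw [key]
  linarith [sum_sum_inner_pow_nonneg C 1, sum_sum_inner_sq_ge hC,
    sum_sum_inner_pow_nonneg C 3, sum_sum_inner_pow_four_ge hC, sum_sum_inner_pow_nonneg C 5]

lemma dodecV_dist {n : ℕ} {x y : EuclideanSpace ℝ (Fin n)} (hx : ‖x‖ = 1) (hy : ‖y‖ = 1) :
    dodecV (dist x y) = dodecW (inner ℝ x y) := by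
  rw [dodecV, dist_eq_norm, norm_sub_sq_real, hx, hy]
  congr 1
  ring

lemma one_add_pow_five_le_dodecW (t : ℝ) : (1 + t) ^ 5 ≤ dodecW t := by
  rw [dodecW]
  exact le_add_of_nonneg_right (by positivity)

lemma energy_dodecV_ge {C : Finset (EuclideanSpace ℝ (Fin 3))} (hC : onSphere C) :
    8 / 3 * (C.card : ℝ) ^ 2 - 16 * C.card ≤ energy dodecV C := by
  have hle : ∑ x ∈ C, (∑ y ∈ C, (1 + inner ℝ x y) ^ 5 - 32) ≤
      ∑ x ∈ C, ∑ y ∈ C, if x = y then 0 else dodecV (dist x y) := by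
    refine Finset.sum_le_sum fun x hx => ?_
    have hdiag : (32 : ℝ) = ∑ y ∈ C, if x = y then 32 else 0 := by simp [hx]
    rw [hdiag, ← Finset.sum_sub_distrib]
    refine Finset.sum_le_sum fun y hy => ?_
    split_ifs with h
    · rw [← h, real_inner_self_eq_norm_sq, hC x hx]
      norm_num
    · rw [dodecV_dist (hC x hx) (hC y hy), sub_zero]
      exact one_add_pow_five_le_dodecW _
  rw [Finset.sum_sub_distrib, Finset.sum_const, nsmul_eq_mul] at hle
  rw [energy]
  linarith [sum_sum_one_add_inner_pow_five_ge hC]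

/-- Labels of the vertices of the regular dodecahedron: the eight cube vertices, and the four
remaining vertices in each of the three coordinate planes. -/
abbrev DodecIndex : Type :=
  (((Fin 3 → Bool) ⊕ (Bool × Bool)) ⊕ (Bool × Bool)) ⊕ (Bool × Bool)

/-- The integer `±1` with the sign given by a Boolean. -/
def boolSign (b : Bool) : ℤ := if b then 1 else -1

/-- The coordinates of `√3` times a vertex of the regular dodecahedron, where the pair `(a, b)`
stands for `a + b φ`. -/
def dodecCoord : DodecIndex → Fin 3 → ℤ × ℤ
  | .inl (.inl (.inl s)) => fun i => (boolSign (s i), 0)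
  | .inl (.inl (.inr s)) => ![0, (-boolSign s.1, boolSign s.1), (0, boolSign s.2)]
  | .inl (.inr s) => ![(0, boolSign s.2), 0, (-boolSign s.1, boolSign s.1)]
  | .inr s => ![(-boolSign s.1, boolSign s.1), (0, boolSign s.2), 0]

/-- Multiplication in `ℤ[φ]`, where the pair `(a, b)` stands for `a + b φ`. -/
def goldenMul (u v : ℤ × ℤ) : ℤ × ℤ := (u.1 * v.1 + u.2 * v.2, u.1 * v.2 + u.2 * v.1 + u.2 * v.2)

/-- The real number `a + b φ`. -/
noncomputable def goldenVal (u : ℤ × ℤ) : ℝ := u.1 + u.2 * phi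

/-- Three times the inner product of two vertices of the regular dodecahedron. -/
def dodecGram (i j : DodecIndex) : ℤ × ℤ :=
  goldenMul (dodecCoord i 0) (dodecCoord j 0) + goldenMul (dodecCoord i 1) (dodecCoord j 1) +
    goldenMul (dodecCoord i 2) (dodecCoord j 2)

/-- The vertices of the regular dodecahedron. -/
noncomputable def dodecPoint (i : DodecIndex) : EuclideanSpace ℝ (Fin 3) :=
  (Real.sqrt 3)⁻¹ • (WithLp.equiv 2 (Fin 3 → ℝ)).symm (fun k => goldenVal (dodecCoord i k))

lemma phi_sq : phi ^ 2 = phi + 1 := by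
  rw [phi]
  linear_combination (1 / 4 : ℝ) * Real.sq_sqrt (show (0 : ℝ) ≤ 5 by norm_num)

lemma phi_bounds : 1 < phi ∧ phi < 2 := by
  have h := phi_sq
  have h₀ : 0 < phi := by rw [phi]; positivity
  constructor <;> nlinarith

lemma phi_inv : phi⁻¹ = phi - 1 :=
  inv_eq_of_mul_eq_one_right (by linear_combination phi_sq)

lemma goldenVal_add (u v : ℤ × ℤ) : goldenVal (u + v) = goldenVal u + goldenVal v := by
  simp only [goldenVal, Prod.fst_add, Prod.snd_add]
  push_cast
  ring

lemma goldenVal_mul (u v : ℤ × ℤ) : goldenVal (goldenMul u v) = goldenVal u * goldenVal v := by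
  simp only [goldenVal, goldenMul]
  push_cast
  linear_combination (-(u.2 * v.2) : ℝ) * phi_sq

lemma inner_dodecPoint (i j : DodecIndex) :
    inner ℝ (dodecPoint i) (dodecPoint j) = goldenVal (dodecGram i j) / 3 := by
  have h : (Real.sqrt 3)⁻¹ ^ 2 = 1 / 3 := by
    rw [inv_pow, Real.sq_sqrt (by norm_num)]; norm_num
  rw [inner_fin_three, dodecGram, goldenVal_add, goldenVal_add]
  simp only [goldenVal_mul, dodecPoint, PiLp.smul_apply, WithLp.equiv_symm_apply, smul_eq_mul]
  linear_combination
    (goldenVal (dodecCoord i 0) * goldenVal (dodecCoord j 0) +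
      goldenVal (dodecCoord i 1) * goldenVal (dodecCoord j 1) +
      goldenVal (dodecCoord i 2) * goldenVal (dodecCoord j 2)) * h

lemma dodecConfig_eq_image : dodecConfig = Finset.univ.image dodecPoint := by
  ext x
  simp only [dodecConfig, Finset.mem_union, Finset.mem_image, Finset.mem_univ, true_and,
    Sum.exists]
  refine or_congr (or_congr (or_congr ?_ ?_) ?_) ?_ <;>
  · refine exists_congr fun s => Eq.congr_left ?_
    rw [dodecPoint]
    congr 2
    ext k
    fin_cases k <;>
    simp [dodecCoord, goldenVal, boolSign, phi_inv] <;> split_ifs <;> (try simp) <;> (try ring)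

lemma dodecGram_eq_iff (i j : DodecIndex) : dodecGram i j = (3, 0) ↔ i = j := by
  revert i j
  refine @of_decide_eq_true _
    (@Fintype.decidableForallFintype _ _ (fun _ => Fintype.decidableForallFintype) _) ?_
  decide +kernel

lemma map_dodecGram (i : DodecIndex) :
    Finset.univ.val.map (dodecGram i) =
      {(3, 0)} + {(-3, 0)} + Multiset.replicate 6 (1, 0) + Multiset.replicate 6 (-1, 0) +
        Multiset.replicate 3 (-1, 2) + Multiset.replicate 3 (1, -2) := by
  revert i
  decide +kernel

lemma norm_dodecPoint (i : DodecIndex) : ‖dodecPoint i‖ = 1 := by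
  have h := real_inner_self_eq_norm_sq (dodecPoint i)
  rw [inner_dodecPoint, (dodecGram_eq_iff i i).2 rfl] at h
  rw [← sq_eq_sq₀ (norm_nonneg _) zero_le_one, ← h]
  norm_num [goldenVal]

lemma dodecPoint_injective : Function.Injective dodecPoint := by
  intro i j hij
  have h := inner_dodecPoint i j
  rw [← hij, real_inner_self_eq_norm_sq, norm_dodecPoint] at h
  have hmem : dodecGram i j ∈ Finset.univ.val.map (dodecGram i) :=
    Multiset.mem_map_of_mem _ (Finset.mem_univ j)
  rw [map_dodecGram] at hmem
  simp only [Multiset.mem_add, Multiset.mem_singleton, Multiset.mem_replicate] at hmem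
  obtain ⟨h₁, h₂⟩ := phi_bounds
  rcases hmem with ((((hg | hg) | ⟨-, hg⟩) | ⟨-, hg⟩) | ⟨-, hg⟩) | ⟨-, hg⟩
  · exact (dodecGram_eq_iff i j).1 hg
  all_goals
    rw [hg, goldenVal] at h
    push_cast at h
    nlinarith [phi_sq]

/-- The remainder term of `dodecW` vanishes at the inner products of distinct vertices. -/
lemma dodecW_eq {t : ℝ} (ht : (t + 1) * (t - 1 / 3) * (t + 1 / 3) * (t ^ 2 - 5 / 9) = 0) :
    dodecW t = (1 + t) ^ 5 := by
  have h : (t + 1) ^ 2 * (t - 1 / 3) ^ 2 * (t + 1 / 3) ^ 2 * (t ^ 2 - 5 / 9) ^ 2 = 0 := by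
    linear_combination ((t + 1) * (t - 1 / 3) * (t + 1 / 3) * (t ^ 2 - 5 / 9)) * ht
  rw [dodecW, h, zero_div, add_zero]

lemma sum_dodecW_dodecGram (i : DodecIndex) :
    (∑ j, if dodecGram i j = (3, 0) then 0 else dodecW (goldenVal (dodecGram i j) / 3)) =
      224 / 3 := by
  have h₁ : dodecW (goldenVal (-3, 0) / 3) = 0 := by
    rw [dodecW_eq] <;> norm_num [goldenVal]
  have h₂ : dodecW (goldenVal (1, 0) / 3) = (4 / 3) ^ 5 := by
    rw [dodecW_eq] <;> norm_num [goldenVal]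
  have h₃ : dodecW (goldenVal (-1, 0) / 3) = (2 / 3) ^ 5 := by
    rw [dodecW_eq] <;> norm_num [goldenVal]
  have h₅ := Real.sq_sqrt (show (0 : ℝ) ≤ 5 by norm_num)
  have hp : goldenVal (-1, 2) / 3 = Real.sqrt 5 / 3 := by
    simp only [goldenVal, phi]; push_cast; ring
  have hm : goldenVal (1, -2) / 3 = -Real.sqrt 5 / 3 := by
    simp only [goldenVal, phi]; push_cast; ring
  have h₄ : dodecW (goldenVal (-1, 2) / 3) + dodecW (goldenVal (1, -2) / 3) =
      2 * (1 + 10 * (5 / 9) + 5 * (5 / 9) ^ 2) := by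
    have hsq : (Real.sqrt 5 / 3) ^ 2 - 5 / 9 = 0 := by linear_combination h₅ / 9
    rw [hp, hm, dodecW_eq (by rw [hsq, mul_zero]),
      dodecW_eq (by rw [neg_div, neg_sq, hsq, mul_zero])]
    linear_combination
      (20 / 9 + 10 / 81 * (Real.sqrt 5 ^ 2 + 5)) * h₅
  have hsum : ∀ F : ℤ × ℤ → ℝ, ∑ j, F (dodecGram i j) =
      F (3, 0) + F (-3, 0) + 6 * F (1, 0) + 6 * F (-1, 0) + 3 * F (-1, 2) + 3 * F (1, -2) := by
    intro F
    have hmap := Multiset.map_map F (dodecGram i) Finset.univ.val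
    rw [map_dodecGram] at hmap
    change (Finset.univ.val.map (F ∘ dodecGram i)).sum = _
    rw [← hmap]
    simp
    ring
  rw [hsum fun u => if u = (3, 0) then 0 else dodecW (goldenVal u / 3)]
  simp only [Prod.mk.injEq]
  norm_num [h₁, h₂, h₃]
  linarith

lemma energy_dodecConfig : energy dodecV dodecConfig = 2240 / 3 := by
  have h : ∀ i j : DodecIndex,
      (if dodecPoint i = dodecPoint j then 0 else dodecV (dist (dodecPoint i) (dodecPoint j))) =
        if dodecGram i j = (3, 0) then 0 else dodecW (goldenVal (dodecGram i j) / 3) := by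
    intro i j
    simp only [dodecPoint_injective.eq_iff, dodecGram_eq_iff,
      dodecV_dist (norm_dodecPoint i) (norm_dodecPoint j), inner_dodecPoint]
  have hcard : Fintype.card DodecIndex = 20 := by simp
  rw [energy, dodecConfig_eq_image, Finset.sum_image dodecPoint_injective.injOn]
  simp_rw [Finset.sum_image dodecPoint_injective.injOn, h, sum_dodecW_dodecGram]
  rw [Finset.sum_const, Finset.card_univ, hcard]
  norm_num

/-- Every 20-point configuration on `S²` has `dodecV`-energy at least `2240/3`, and the
regular dodecahedron attains this bound. -/
theorem dodecahedron_energy_bound :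
    (∀ C : Finset (EuclideanSpace ℝ (Fin 3)), C.card = 20 → onSphere C →
      (2240 : ℝ) / 3 ≤ energy dodecV C) ∧
    energy dodecV dodecConfig = 2240 / 3 := by
  refine ⟨fun C hcard hC => ?_, energy_dodecConfig⟩
  have h := energy_dodecV_ge hC
  rw [hcard] at h
  norm_num at h
  exact h
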